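/- Let q ∈ (0,1/2), let a = (a_i) be a sequence of positive integers, and let (C,D) be the pair of generalised Cantor sets generated by (q,a), with C×D ⊂ ℝ² carrying the Euclidean metric. Then dim_LB(C×D) = dim_B(C×D) = dim_A(C×D) = −log 2/log q. -/

import Mathlib

open Metric Set Filter
open scoped ENNReal NNReal

namespace Paper

noncomputable def coverNum {X : Type*} [MetricSpace X] (F : Set X) (r : ℝ) : ℝ≥0∞ :=
  ⨅ (s : Finset X) (_ : F ⊆ ⋃ x ∈ s, closedBall x r), (s.card : ℝ≥0∞)

noncomputable def diamCoverNum {X : Type*} [MetricSpace X] (F : Set X) (r : ℝ) : ℝ≥0∞ :=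
  ⨅ (U : Finset (Set X)) (_ : F ⊆ ⋃₀ ↑U)
    (_ : ∀ A ∈ U, EMetric.diam A ≤ ENNReal.ofReal r), (U.card : ℝ≥0∞)

noncomputable def lowerBoxDim {X : Type*} [MetricSpace X] (F : Set X) : ℝ :=
  Filter.liminf (fun r : ℝ => Real.log (coverNum F r).toReal / (-Real.log r))
    (nhdsWithin 0 (Set.Ioi 0))

noncomputable def upperBoxDim {X : Type*} [MetricSpace X] (F : Set X) : ℝ :=
  Filter.limsup (fun r : ℝ => Real.log (coverNum F r).toReal / (-Real.log r))
    (nhdsWithin 0 (Set.Ioi 0))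

def IsHomogeneous {X : Type*} [MetricSpace X] (F : Set X) (s : ℝ) : Prop :=
  ∀ δ₀ : ℝ, 0 < δ₀ → ∃ C : ℝ, 0 < C ∧
    ∀ x ∈ F, ∀ δ ρ : ℝ, 0 < ρ → ρ < δ → δ ≤ δ₀ →
      coverNum (closedBall x δ ∩ F) ρ ≤ ENNReal.ofReal (C * (δ / ρ) ^ s)

noncomputable def assouadDim {X : Type*} [MetricSpace X] (F : Set X) : EReal :=
  sInf ((fun s : ℝ => (s : EReal)) '' {s : ℝ | 0 ≤ s ∧ IsHomogeneous F s})

def EquiHomogeneous {X : Type*} [MetricSpace X] (F : Set X) : Prop :=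
  ∀ δ₀ : ℝ, 0 < δ₀ → ∃ M : ℝ≥0, 1 ≤ M ∧ ∃ c₁ c₂ : ℝ, 0 < c₁ ∧ 0 < c₂ ∧
    ∀ δ ρ : ℝ, 0 < ρ → ρ < δ → δ ≤ δ₀ →
      (⨆ x ∈ F, coverNum (closedBall x δ ∩ F) ρ) ≤
        (M : ℝ≥0∞) * ⨅ x ∈ F, coverNum (closedBall x (c₁ * δ) ∩ F) (c₂ * ρ)

noncomputable def cantorLen (lam : ℕ → ℝ) (n : ℕ) : ℝ := ∏ i ∈ Finset.range n, lam i

noncomputable def cantorPre (lam : ℕ → ℝ) (n : ℕ) : Set ℝ :=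
  ⋃ ε : ℕ → Bool,
    Set.Icc (∑ i ∈ Finset.range n, if ε i then cantorLen lam i - cantorLen lam (i + 1) else 0)
      ((∑ i ∈ Finset.range n, if ε i then cantorLen lam i - cantorLen lam (i + 1) else 0) +
        cantorLen lam n)

noncomputable def cantorSet (lam : ℕ → ℝ) : Set ℝ := ⋂ n : ℕ, cantorPre lam n

open Classical in
noncomputable def lamSeq (q : ℝ) (a : ℕ → ℕ) (i : ℕ) : ℝ :=
  if h : ∃ k : ℕ, i + 1 = ∑ j ∈ Finset.range (k + 1), a (2 * j) then
    q ^ (a (2 * h.choose + 1) + 1)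
  else q

open Classical in
noncomputable def muSeq (q : ℝ) (a : ℕ → ℕ) (i : ℕ) : ℝ :=
  if h : ∃ k : ℕ, i + 1 = a 0 + ∑ j ∈ Finset.range (k + 1), a (2 * j + 1) then
    q ^ (a (2 * h.choose + 2) + 1)
  else q

noncomputable def prodSetL2 (C D : Set ℝ) : Set (WithLp 2 (ℝ × ℝ)) :=
  (WithLp.equiv 2 (ℝ × ℝ)).symm '' (C ×ˢ D)

section CoverNum

variable {X : Type*} [MetricSpace X] {F : Set X}

lemma coverNum_le_card {r : ℝ} {S : Finset X} (h : ∀ x ∈ F, ∃ y ∈ S, dist x y ≤ r) :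
    coverNum F r ≤ S.card := by
  refine iInf₂_le S fun x hx => ?_
  obtain ⟨y, hy, hxy⟩ := h x hx
  exact mem_iUnion₂.2 ⟨y, hy, hxy⟩

/-- A separated subset bounds the covering number from below. -/
lemma card_le_coverNum {r : ℝ} {P : Finset X} (hP : ∀ x ∈ P, x ∈ F)
    (hsep : ∀ x ∈ P, ∀ y ∈ P, dist x y ≤ 2 * r → x = y) : (P.card : ℝ≥0∞) ≤ coverNum F r := by
  refine le_iInf₂ fun S hS => ?_
  have h : ∀ x ∈ P, ∃ y ∈ S, dist x y ≤ r := fun x hx => by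
    obtain ⟨y, hy, hxy⟩ := mem_iUnion₂.1 (hS (hP x hx))
    exact ⟨y, hy, hxy⟩
  choose! f hf hfr using h
  have : P.card ≤ S.card := Finset.card_le_card_of_injOn f hf fun x hx y hy hxy => by
    refine hsep x hx y hy ?_
    have h1 := hfr x hx
    have h2 := hfr y hy
    rw [← hxy, dist_comm] at h2
    linarith [dist_triangle x (f x) y]
  exact_mod_cast this

lemma tendsto_add_div_neg_log (s c : ℝ) :
    Tendsto (fun r : ℝ => s + c / (-Real.log r)) (nhdsWithin 0 (Ioi 0)) (nhds s) := by
  have h : Tendsto (fun r : ℝ => -Real.log r) (nhdsWithin 0 (Ioi 0)) atTop :=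
    tendsto_neg_atBot_atTop.comp Real.tendsto_log_nhdsGT_zero
  simpa using (h.const_div_atTop c).const_add s

lemma log_mul_rpow_neg_div {c s r : ℝ} (hc : 0 < c) (hr : 0 < r) (hr1 : r < 1) :
    Real.log (c * r ^ (-s)) / (-Real.log r) = s + Real.log c / (-Real.log r) := by
  have hl : Real.log r < 0 := Real.log_neg hr hr1
  rw [Real.log_mul hc.ne' (Real.rpow_pos_of_pos hr _).ne', Real.log_rpow hr]
  field_simp [hl.ne]
  ring

/-- A homogeneous set of finite diameter satisfies a power-law bound on its covering numbers. -/
lemma IsHomogeneous.coverNum_le {s R : ℝ} (h : IsHomogeneous F s) (hF : F.Nonempty) (hR : 0 < R)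
    (hb : ∀ x ∈ F, F ⊆ closedBall x R) :
    ∃ C : ℝ, 0 < C ∧ ∀ r, 0 < r → r < R → coverNum F r ≤ ENNReal.ofReal (C * r ^ (-s)) := by
  obtain ⟨C, hC, hCb⟩ := h R hR
  obtain ⟨x, hx⟩ := hF
  refine ⟨C * R ^ s, mul_pos hC (Real.rpow_pos_of_pos hR _), fun r hr hrR => ?_⟩
  have := hCb x hx R r hr hrR le_rfl
  rwa [inter_eq_self_of_subset_right (hb x hx), Real.div_rpow hR.le hr.le, div_eq_mul_inv,
    ← Real.rpow_neg hr.le, ← mul_assoc] at this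

/-- A homogeneous set whose covering numbers obey the matching lower power law has all its
box-counting and Assouad dimensions equal. -/
lemma dims_eq_of_isHomogeneous {s R c r₀ : ℝ} (hs : 0 ≤ s) (h : IsHomogeneous F s)
    (hF : F.Nonempty) (hR : 0 < R) (hb : ∀ x ∈ F, F ⊆ closedBall x R) (hc : 0 < c) (hr₀ : 0 < r₀)
    (hlow : ∀ r, 0 < r → r < r₀ → ENNReal.ofReal (c * r ^ (-s)) ≤ coverNum F r) :
    lowerBoxDim F = s ∧ upperBoxDim F = s ∧ assouadDim F = (s : EReal) := by
  have upper : ∀ t, IsHomogeneous F t → ∃ C : ℝ, 0 < C ∧ ∀ᶠ r in nhdsWithin 0 (Ioi 0),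
      s + Real.log c / (-Real.log r) ≤ Real.log (coverNum F r).toReal / (-Real.log r) ∧
      Real.log (coverNum F r).toReal / (-Real.log r) ≤ t + Real.log C / (-Real.log r) := by
    intro t ht
    obtain ⟨C, hC, hCb⟩ := ht.coverNum_le hF hR hb
    refine ⟨C, hC, ?_⟩
    have hev : ∀ᶠ r in nhdsWithin (0 : ℝ) (Ioi 0), r ∈ Ioo 0 (min 1 (min R r₀)) :=
      Ioo_mem_nhdsGT (by positivity)
    filter_upwards [hev] with r hr
    have hr0 : 0 < r := hr.1
    have hr1 : r < 1 := hr.2.trans_le (min_le_left _ _)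
    have hrR : r < R := hr.2.trans_le ((min_le_right _ _).trans (min_le_left _ _))
    have hrr : r < r₀ := hr.2.trans_le ((min_le_right _ _).trans (min_le_right _ _))
    have h1 := hlow r hr0 hrr
    have h2 := hCb r hr0 hrR
    have hfin : coverNum F r ≠ ⊤ := ne_top_of_le_ne_top ENNReal.ofReal_ne_top h2
    have hpos : 0 < c * r ^ (-s) := mul_pos hc (Real.rpow_pos_of_pos hr0 _)
    have hposC : 0 < C * r ^ (-t) := mul_pos hC (Real.rpow_pos_of_pos hr0 _)
    have h1' : c * r ^ (-s) ≤ (coverNum F r).toReal := (ENNReal.ofReal_le_iff_le_toReal hfin).1 h1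
    have h2' : (coverNum F r).toReal ≤ C * r ^ (-t) := ENNReal.toReal_le_of_le_ofReal hposC.le h2
    have hl : 0 < -Real.log r := neg_pos.2 (Real.log_neg hr0 hr1)
    rw [← log_mul_rpow_neg_div hc hr0 hr1, ← log_mul_rpow_neg_div hC hr0 hr1]
    exact ⟨by gcongr, div_le_div_of_nonneg_right
      (Real.log_le_log (hpos.trans_le h1') h2') hl.le⟩
  have lim : Tendsto (fun r : ℝ => Real.log (coverNum F r).toReal / (-Real.log r))
      (nhdsWithin 0 (Ioi 0)) (nhds s) := by
    obtain ⟨C, -, hC⟩ := upper s h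
    exact tendsto_of_tendsto_of_tendsto_of_le_of_le' (tendsto_add_div_neg_log s _)
      (tendsto_add_div_neg_log s _) (hC.mono fun _ h => h.1) (hC.mono fun _ h => h.2)
  refine ⟨lim.liminf_eq, lim.limsup_eq, le_antisymm (sInf_le ⟨s, ⟨hs, h⟩, rfl⟩) (le_sInf ?_)⟩
  rintro _ ⟨t, ⟨-, ht⟩, rfl⟩
  obtain ⟨C, -, hC⟩ := upper t ht
  exact EReal.coe_le_coe_iff.2 (le_of_tendsto_of_tendsto lim (tendsto_add_div_neg_log t _)
    (hC.mono fun _ h => h.2))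

end CoverNum

section CantorSet

/-- The left endpoint of the `n`-th generation interval with address `ε`. -/
noncomputable def cantorLeft (lam : ℕ → ℝ) (ε : ℕ → Bool) (n : ℕ) : ℝ :=
  ∑ i ∈ Finset.range n, if ε i then cantorLen lam i - cantorLen lam (i + 1) else 0

variable {lam : ℕ → ℝ}

lemma mem_cantorPre {n : ℕ} {x : ℝ} : x ∈ cantorPre lam n ↔
    ∃ ε, cantorLeft lam ε n ≤ x ∧ x ≤ cantorLeft lam ε n + cantorLen lam n := by
  simp [cantorPre, cantorLeft]

lemma cantorLen_pos (h0 : ∀ i, 0 < lam i) (n : ℕ) : 0 < cantorLen lam n :=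
  Finset.prod_pos fun i _ => h0 i

lemma cantorLen_succ (n : ℕ) : cantorLen lam (n + 1) = cantorLen lam n * lam n :=
  Finset.prod_range_succ _ _

lemma two_mul_cantorLen_succ_le (h0 : ∀ i, 0 < lam i) (h : ∀ i, lam i ≤ 1 / 2) (n : ℕ) :
    2 * cantorLen lam (n + 1) ≤ cantorLen lam n := by
  rw [cantorLen_succ]
  nlinarith [cantorLen_pos h0 n, h n]

lemma cantorLen_anti (h0 : ∀ i, 0 < lam i) (h : ∀ i, lam i ≤ 1 / 2) : Antitone (cantorLen lam) :=
  antitone_nat_of_succ_le fun n => by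
    linarith [two_mul_cantorLen_succ_le h0 h n, cantorLen_pos h0 (n + 1)]

lemma cantorLeft_succ (ε : ℕ → Bool) (n : ℕ) : cantorLeft lam ε (n + 1) = cantorLeft lam ε n +
    if ε n then cantorLen lam n - cantorLen lam (n + 1) else 0 :=
  Finset.sum_range_succ _ _

lemma cantorLeft_mono (h0 : ∀ i, 0 < lam i) (h : ∀ i, lam i ≤ 1 / 2) (ε : ℕ → Bool) :
    Monotone (cantorLeft lam ε) :=
  monotone_nat_of_le_succ fun n => by
    have := cantorLen_anti h0 h n.le_succ
    rw [cantorLeft_succ]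
    split_ifs <;> simp_all

lemma cantorRight_anti (h0 : ∀ i, 0 < lam i) (h : ∀ i, lam i ≤ 1 / 2) (ε : ℕ → Bool) :
    Antitone fun n => cantorLeft lam ε n + cantorLen lam n :=
  antitone_nat_of_succ_le fun n => by
    have := cantorLen_anti h0 h n.le_succ
    rw [cantorLeft_succ]
    split_ifs
    · linarith
    · simpa using this

lemma cantorLeft_congr {ε ε' : ℕ → Bool} {n : ℕ} (h : ∀ i < n, ε i = ε' i) :
    cantorLeft lam ε n = cantorLeft lam ε' n :=
  Finset.sum_congr rfl fun i hi => by rw [h i (Finset.mem_range.1 hi)]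

lemma cantorSet_subset_Icc : cantorSet lam ⊆ Icc 0 1 := fun x hx => by
  obtain ⟨ε, h1, h2⟩ := mem_cantorPre.1 (mem_iInter.1 hx 0)
  simp only [cantorLeft, cantorLen, Finset.range_zero, Finset.sum_empty, Finset.prod_empty,
    zero_add] at h1 h2
  exact ⟨h1, h2⟩

/-- Extend a finite address by zeros. -/
def extendWord {n : ℕ} (w : Fin n → Bool) (i : ℕ) : Bool := if h : i < n then w ⟨i, h⟩ else false

lemma cantorLeft_extendWord_mem (h0 : ∀ i, 0 < lam i) (h : ∀ i, lam i ≤ 1 / 2) {n : ℕ}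
    (w : Fin n → Bool) : cantorLeft lam (extendWord w) n ∈ cantorSet lam := by
  refine mem_iInter.2 fun m => mem_cantorPre.2 ⟨extendWord w, ?_⟩
  have hstab : ∀ k, cantorLeft lam (extendWord w) (n + k) = cantorLeft lam (extendWord w) n := by
    intro k
    induction k with
    | zero => rfl
    | succ k ih => rw [← add_assoc, cantorLeft_succ, ih]; simp [extendWord]
  have hm := cantorLen_pos h0 m
  have hn := cantorLen_pos h0 n
  rcases le_total m n with hmn | hmn
  · have := cantorRight_anti h0 h (extendWord w) hmn
    exact ⟨cantorLeft_mono h0 h _ hmn, by simp only at this; linarith⟩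
  · obtain ⟨k, rfl⟩ := Nat.exists_eq_add_of_le hmn
    rw [hstab]
    exact ⟨le_rfl, by linarith⟩

lemma cantorLeft_separated_aux (h0 : ∀ i, 0 < lam i) (h : ∀ i, lam i ≤ 1 / 2) {ε ε' : ℕ → Bool}
    {i n : ℕ} (hi : i < n) (heq : ∀ j < i, ε j = ε' j) (ht : ε i = true) (hf : ε' i = false) :
    cantorLen lam n ≤ cantorLeft lam ε n - cantorLeft lam ε' n := by
  have h1 := cantorLeft_mono h0 h ε (Nat.succ_le_of_lt hi)
  have h2 := cantorRight_anti h0 h ε' (Nat.succ_le_of_lt hi)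
  simp only [Nat.succ_eq_add_one, cantorLeft_succ, ht, hf, cantorLeft_congr heq] at h1 h2
  have h3 := two_mul_cantorLen_succ_le h0 h i
  simp only [if_true, Bool.false_eq_true, if_false] at h1 h2
  linarith

lemma cantorLeft_separated (h0 : ∀ i, 0 < lam i) (h : ∀ i, lam i ≤ 1 / 2) {ε ε' : ℕ → Bool}
    {n : ℕ} (hne : ∃ i < n, ε i ≠ ε' i) :
    cantorLen lam n ≤ |cantorLeft lam ε n - cantorLeft lam ε' n| := by
  classical
  obtain ⟨hi, hd⟩ := Nat.find_spec hne
  have heq : ∀ j < Nat.find hne, ε j = ε' j := fun j hj => by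
    by_contra hc
    exact Nat.find_min hne hj ⟨hj.trans hi, hc⟩
  cases ht : ε (Nat.find hne)
  · have hf : ε' (Nat.find hne) = true := by rw [ht] at hd; simpa using hd.symm
    rw [abs_sub_comm]
    exact (cantorLeft_separated_aux h0 h hi (fun j hj => (heq j hj).symm) hf ht).trans
      (le_abs_self _)
  · have hf : ε' (Nat.find hne) = false := by rw [ht] at hd; simpa using hd.symm
    exact (cantorLeft_separated_aux h0 h hi heq ht hf).trans (le_abs_self _)

/-- The left endpoints of the `n`-th generation intervals. -/
noncomputable def cantorVertices (lam : ℕ → ℝ) (n : ℕ) : Finset ℝ :=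
  Finset.univ.image fun w : Fin n → Bool => cantorLeft lam (extendWord w) n

lemma cantorLeft_mem_vertices (ε : ℕ → Bool) (n : ℕ) : cantorLeft lam ε n ∈ cantorVertices lam n :=
  Finset.mem_image.2 ⟨fun i => ε i, Finset.mem_univ _,
    cantorLeft_congr fun i hi => by simp [extendWord, hi]⟩

lemma cantorVertices_subset (h0 : ∀ i, 0 < lam i) (h : ∀ i, lam i ≤ 1 / 2) {n : ℕ} {v : ℝ}
    (hv : v ∈ cantorVertices lam n) : v ∈ cantorSet lam := by
  obtain ⟨w, -, rfl⟩ := Finset.mem_image.1 hv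
  exact cantorLeft_extendWord_mem h0 h w

lemma extendWord_ne {n : ℕ} {w w' : Fin n → Bool} (hne : w ≠ w') :
    ∃ i < n, extendWord w i ≠ extendWord w' i := by
  obtain ⟨i, hi⟩ := Function.ne_iff.1 hne
  exact ⟨i, i.2, by simpa [extendWord] using hi⟩

lemma cantorVertices_separated (h0 : ∀ i, 0 < lam i) (h : ∀ i, lam i ≤ 1 / 2) {n : ℕ} {u v : ℝ}
    (hu : u ∈ cantorVertices lam n) (hv : v ∈ cantorVertices lam n) (huv : u ≠ v) :
    cantorLen lam n ≤ |u - v| := by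
  obtain ⟨w, -, rfl⟩ := Finset.mem_image.1 hu
  obtain ⟨w', -, rfl⟩ := Finset.mem_image.1 hv
  exact cantorLeft_separated h0 h (extendWord_ne fun hc => huv (by rw [hc]))

lemma card_cantorVertices (h0 : ∀ i, 0 < lam i) (h : ∀ i, lam i ≤ 1 / 2) (n : ℕ) :
    (cantorVertices lam n).card = 2 ^ n := by
  rw [cantorVertices, Finset.card_image_of_injective]
  · simp
  · intro w w' hww
    by_contra hne
    have h1 := cantorLeft_separated h0 h (extendWord_ne hne)
    simp only at hww
    rw [hww, sub_self, abs_zero] at h1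
    exact (cantorLen_pos h0 n).not_ge h1

lemma card_le_of_separated {S : Finset ℝ} {a d : ℝ} {K : ℕ} (hd : 0 < d)
    (hsep : ∀ u ∈ S, ∀ v ∈ S, u ≠ v → d ≤ |u - v|) (hS : ∀ u ∈ S, a ≤ u ∧ u ≤ a + K * d) :
    S.card ≤ K + 1 := by
  have h : S.card ≤ (Finset.Icc (0 : ℤ) K).card := by
    refine Finset.card_le_card_of_injOn (fun u => ⌊(u - a) / d⌋) (fun u hu => ?_) ?_
    · obtain ⟨h1, h2⟩ := hS u hu
      have h3 : (u - a) / d ≤ (K : ℤ) := by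
        rw [div_le_iff₀ hd]; push_cast; linarith
      simp only [Finset.coe_Icc, mem_Icc]
      exact ⟨Int.floor_nonneg.2 (div_nonneg (by linarith) hd.le),
        Int.cast_le.1 ((Int.floor_le _).trans h3)⟩
    · intro u hu v hv huv
      by_contra hne
      have h1 := Int.abs_sub_lt_one_of_floor_eq_floor huv
      rw [← sub_div, abs_div, abs_of_pos hd, div_lt_one hd] at h1
      have h2 := hsep u hu v hv hne
      rw [sub_sub_sub_cancel_right] at h1
      linarith
  simpa using h

/-- A set of size comparable to the `n`-th generation length is covered by boundedly many times
`2 ^ k` intervals of generation `n + k`. -/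
lemma exists_cantor_cover (h0 : ∀ i, 0 < lam i) (h : ∀ i, lam i ≤ 1 / 2) (x : ℝ) {R : ℝ}
    {n K : ℕ} (k : ℕ) (hR : 2 * R ≤ K * cantorLen lam n) :
    ∃ S : Finset ℝ, S.card ≤ (K + 2) * 2 ^ k ∧
      ∀ y ∈ cantorSet lam, |y - x| ≤ R → ∃ s ∈ S, |y - s| ≤ cantorLen lam (n + k) := by
  classical
  let V := (cantorVertices lam n).filter fun v => x - R - cantorLen lam n ≤ v ∧ v ≤ x + R
  let T : Finset ℝ := Finset.univ.image fun w : Fin k → Bool =>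
    ∑ i ∈ Finset.range k,
      if extendWord w i then cantorLen lam (n + i) - cantorLen lam (n + i + 1) else 0
  have hV : V.card ≤ K + 2 := by
    refine card_le_of_separated (K := K + 1) (a := x - R - cantorLen lam n) (cantorLen_pos h0 n)
      (fun u hu v hv huv => cantorVertices_separated h0 h (Finset.mem_filter.1 hu).1
        (Finset.mem_filter.1 hv).1 huv) fun u hu => ?_
    obtain ⟨-, h1, h2⟩ := Finset.mem_filter.1 hu
    refine ⟨h1, h2.trans ?_⟩
    push_cast
    linarith
  have hT : T.card ≤ 2 ^ k := Finset.card_image_le.trans (by simp)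
  refine ⟨(V ×ˢ T).image fun p => p.1 + p.2, ?_, fun y hy hyx => ?_⟩
  · refine Finset.card_image_le.trans ?_
    rw [Finset.card_product]
    exact Nat.mul_le_mul hV hT
  obtain ⟨ε, h1, h2⟩ := mem_cantorPre.1 (mem_iInter.1 hy (n + k))
  have h3 := cantorLeft_mono h0 h ε (Nat.le_add_right n k)
  have h4 := cantorRight_anti h0 h ε (Nat.le_add_right n k)
  simp only at h4
  obtain ⟨h5, h6⟩ := abs_le.1 hyx
  refine ⟨cantorLeft lam ε (n + k), Finset.mem_image.2 ⟨(cantorLeft lam ε n,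
    ∑ i ∈ Finset.range k,
      if ε (n + i) then cantorLen lam (n + i) - cantorLen lam (n + i + 1) else 0),
    Finset.mem_product.2 ⟨Finset.mem_filter.2 ⟨cantorLeft_mem_vertices ε n, ?_, ?_⟩, ?_⟩, ?_⟩, ?_⟩
  · linarith
  · linarith
  · refine Finset.mem_image.2 ⟨fun i => ε (n + i), Finset.mem_univ _, ?_⟩
    refine Finset.sum_congr rfl fun i hi => ?_
    simp [extendWord, Finset.mem_range.1 hi]
  · exact (Finset.sum_range_add _ n k).symm
  · rw [abs_le]; constructor <;> linarith [cantorLen_pos h0 (n + k)]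

end CantorSet

section Lengths

/-- The interval lengths of a Cantor set whose ratios equal `q` except at the ends of successive
blocks of lengths `b 0, b 1, …`, where the ratio is `q ^ (g k + 1)`. -/
lemma cantorLen_eq_pow {lam : ℕ → ℝ} {q : ℝ} {s : ℕ} {b g : ℕ → ℕ} (hb : ∀ k, 0 < b k)
    (hjump : ∀ k i, i + 1 = s + ∑ j ∈ Finset.range (k + 1), b j → lam i = q ^ (g k + 1))
    (hreg : ∀ i, (∀ k, i + 1 ≠ s + ∑ j ∈ Finset.range (k + 1), b j) → lam i = q) :
    (∀ t < s + b 0, cantorLen lam t = q ^ t) ∧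
    ∀ k t, t < b k → cantorLen lam (s + ∑ j ∈ Finset.range k, b j + t) =
      q ^ (s + ∑ j ∈ Finset.range k, (b j + g j) + t) := by
  have hmono : StrictMono fun k => s + ∑ j ∈ Finset.range k, b j :=
    strictMono_nat_of_lt_succ fun k => by
      simp only [Finset.sum_range_succ]; have := hb k; omega
  have hq : ∀ k i, (k = 0 ∨ s + ∑ j ∈ Finset.range k, b j < i + 1) →
      i + 1 < s + ∑ j ∈ Finset.range (k + 1), b j → lam i = q := by
    intro k i h1 h2
    refine hreg i fun k' h' => ?_
    have h3 : k' + 1 < k + 1 := hmono.lt_iff_lt.1 (by omega)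
    rcases h1 with rfl | h1
    · omega
    · have h4 : k < k' + 1 := hmono.lt_iff_lt.1 (by omega)
      omega
  have hfirst : ∀ t < s + b 0, cantorLen lam t = q ^ t := by
    intro t
    induction t with
    | zero => simp [cantorLen]
    | succ t ih =>
      intro ht
      rw [cantorLen_succ, ih (by omega), hq 0 t (Or.inl rfl) (by simpa using ht), pow_succ]
  refine ⟨hfirst, fun k => ?_⟩
  have hblock : ∀ k, cantorLen lam (s + ∑ j ∈ Finset.range k, b j) =
      q ^ (s + ∑ j ∈ Finset.range k, (b j + g j)) → ∀ t, t < b k →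
      cantorLen lam (s + ∑ j ∈ Finset.range k, b j + t) =
      q ^ (s + ∑ j ∈ Finset.range k, (b j + g j) + t) := by
    intro k h t
    induction t with
    | zero => intro _; simpa using h
    | succ t ih =>
      intro ht
      rw [← add_assoc, cantorLen_succ, ih (by omega), hq k _ (Or.inr (by omega))
        (by rw [Finset.sum_range_succ]; omega), ← add_assoc, pow_succ]
  refine hblock k ?_
  induction k with
  | zero => simpa using hfirst s (by have := hb 0; omega)
  | succ k ih =>
    have hk := hb k
    have h1 := hblock k ih (b k - 1) (by omega)
    have h2 : s + ∑ j ∈ Finset.range (k + 1), b j =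
        (s + ∑ j ∈ Finset.range k, b j + (b k - 1)) + 1 := by
      rw [Finset.sum_range_succ]; omega
    rw [h2, cantorLen_succ, h1, hjump k _ h2.symm, ← pow_add]
    congr 1
    rw [Finset.sum_range_succ]
    omega

variable {q : ℝ} {a : ℕ → ℕ}

lemma lamSeq_mem (hq : 0 < q) (hq1 : q < 1) (i : ℕ) : 0 < lamSeq q a i ∧ lamSeq q a i ≤ q := by
  unfold lamSeq
  split_ifs
  · exact ⟨pow_pos hq _, pow_le_of_le_one hq.le hq1.le (Nat.succ_ne_zero _)⟩
  · exact ⟨hq, le_rfl⟩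

lemma muSeq_mem (hq : 0 < q) (hq1 : q < 1) (i : ℕ) : 0 < muSeq q a i ∧ muSeq q a i ≤ q := by
  unfold muSeq
  split_ifs
  · exact ⟨pow_pos hq _, pow_le_of_le_one hq.le hq1.le (Nat.succ_ne_zero _)⟩
  · exact ⟨hq, le_rfl⟩

lemma sum_range_injective {b : ℕ → ℕ} (hb : ∀ k, 0 < b k) {k k' : ℕ}
    (h : ∑ j ∈ Finset.range (k + 1), b j = ∑ j ∈ Finset.range (k' + 1), b j) : k = k' := by
  have hmono : StrictMono fun k => ∑ j ∈ Finset.range k, b j :=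
    strictMono_nat_of_lt_succ fun k => by
      simp only [Finset.sum_range_succ]; have := hb k; omega
  simpa using hmono.injective h

lemma sum_even_add_odd (a : ℕ → ℕ) (k : ℕ) :
    ∑ j ∈ Finset.range k, (a (2 * j) + a (2 * j + 1)) = ∑ j ∈ Finset.range (2 * k), a j := by
  induction k with
  | zero => simp
  | succ k ih => rw [Finset.sum_range_succ, ih, mul_add, mul_one, Finset.sum_range_succ,
      Finset.sum_range_succ, add_assoc]

lemma sum_odd_add_even (a : ℕ → ℕ) (k : ℕ) :
    a 0 + ∑ j ∈ Finset.range k, (a (2 * j + 1) + a (2 * j + 2)) =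
      ∑ j ∈ Finset.range (2 * k + 1), a j := by
  induction k with
  | zero => simp
  | succ k ih => rw [Finset.sum_range_succ, ← add_assoc, ih, mul_add, mul_one,
      Finset.sum_range_succ _ (2 * k + 2), Finset.sum_range_succ _ (2 * k + 1), add_assoc]

lemma cantorLen_lamSeq (ha : ∀ i, 0 < a i) {k t : ℕ} (ht : t < a (2 * k)) :
    cantorLen (lamSeq q a) (∑ j ∈ Finset.range k, a (2 * j) + t) =
      q ^ (∑ j ∈ Finset.range (2 * k), a j + t) := by
  have h := (cantorLen_eq_pow (lam := lamSeq q a) (q := q) (s := 0) (b := fun j => a (2 * j))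
    (g := fun j => a (2 * j + 1)) (fun k => ha _) (fun k i hi => ?_) fun i hi => ?_).2 k t ht
  · simpa only [zero_add, sum_even_add_odd] using h
  · rw [zero_add] at hi
    have hex : ∃ k : ℕ, i + 1 = ∑ j ∈ Finset.range (k + 1), a (2 * j) := ⟨k, hi⟩
    rw [lamSeq, dif_pos hex, sum_range_injective (b := fun j => a (2 * j)) (fun k => ha _)
      (hex.choose_spec.symm.trans hi)]
  · simp only [zero_add] at hi
    rw [lamSeq, dif_neg (not_exists.2 hi)]

lemma cantorLen_muSeq (ha : ∀ i, 0 < a i) :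
    (∀ t < a 0 + a 1, cantorLen (muSeq q a) t = q ^ t) ∧ ∀ k t, t < a (2 * k + 1) →
    cantorLen (muSeq q a) (a 0 + ∑ j ∈ Finset.range k, a (2 * j + 1) + t) =
      q ^ (∑ j ∈ Finset.range (2 * k + 1), a j + t) := by
  have h := cantorLen_eq_pow (lam := muSeq q a) (q := q) (s := a 0) (b := fun j => a (2 * j + 1))
    (g := fun j => a (2 * j + 2)) (fun k => ha _) (fun k i hi => ?_) fun i hi => ?_
  · simpa only [sum_odd_add_even] using h
  · have hex : ∃ k : ℕ, i + 1 = a 0 + ∑ j ∈ Finset.range (k + 1), a (2 * j + 1) := ⟨k, hi⟩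
    rw [muSeq, dif_pos hex, sum_range_injective (b := fun j => a (2 * j + 1)) (fun k => ha _)
      (add_left_cancel (hex.choose_spec.symm.trans hi))]
  · rw [muSeq, dif_neg (not_exists.2 hi)]

/-- At every scale `q ^ i` the generations reached by the two Cantor sets sum to `i` up to a
bounded error. -/
lemma exists_generations (hq : 0 < q) (hq1 : q < 1) (ha : ∀ i, 0 < a i) (i : ℕ) :
    ∃ c d : ℕ, q ^ i ≤ cantorLen (lamSeq q a) c ∧ cantorLen (lamSeq q a) (c + 1) ≤ q ^ (i + 1) ∧
      q ^ i ≤ cantorLen (muSeq q a) d ∧ cantorLen (muSeq q a) (d + 1) ≤ q ^ (i + 1) ∧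
      i ≤ c + d ∧ c + d ≤ i + a 0 := by
  have hpow : ∀ {m n : ℕ}, m ≤ n → q ^ n ≤ q ^ m := fun h =>
    pow_le_pow_of_le_one hq.le hq1.le h
  have hC : ∀ {n m}, cantorLen (lamSeq q a) n = q ^ m →
      cantorLen (lamSeq q a) (n + 1) ≤ q ^ (m + 1) := fun {n m} h => by
    rw [cantorLen_succ, h, pow_succ]
    exact mul_le_mul_of_nonneg_left (lamSeq_mem hq hq1 n).2 (pow_pos hq _).le
  have hD : ∀ {n m}, cantorLen (muSeq q a) n = q ^ m →
      cantorLen (muSeq q a) (n + 1) ≤ q ^ (m + 1) := fun {n m} h => by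
    rw [cantorLen_succ, h, pow_succ]
    exact mul_le_mul_of_nonneg_left (muSeq_mem hq hq1 n).2 (pow_pos hq _).le
  have ha' := sum_even_add_odd a
  obtain ⟨hM0, hM⟩ := cantorLen_muSeq (q := q) ha
  obtain ⟨K, hK1, hK2⟩ : ∃ K, ∑ j ∈ Finset.range K, a j ≤ i ∧
      i < ∑ j ∈ Finset.range (K + 1), a j := by
    classical
    have hex : ∃ K, i < ∑ j ∈ Finset.range (K + 1), a j := ⟨i, by
      have : ∑ j ∈ Finset.range (i + 1), 1 ≤ ∑ j ∈ Finset.range (i + 1), a j :=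
        Finset.sum_le_sum fun j _ => ha j
      simp only [Finset.sum_const, Finset.card_range, smul_eq_mul, mul_one] at this
      omega⟩
    refine ⟨Nat.find hex, ?_, Nat.find_spec hex⟩
    rcases hf : Nat.find hex with _ | K
    · simp
    · exact not_lt.1 (Nat.find_min hex (m := K) (by omega))
  have hsplit : ∀ k, a 0 + (∑ j ∈ Finset.range k, a (2 * j) +
      ∑ j ∈ Finset.range k, a (2 * j + 1)) = a 0 + ∑ j ∈ Finset.range (2 * k), a j := fun k => by
    rw [← ha' k, Finset.sum_add_distrib]
  obtain ⟨t, rfl⟩ := Nat.exists_eq_add_of_le hK1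
  rw [Finset.sum_range_succ] at hK2
  rcases Nat.even_or_odd' K with ⟨k, rfl | rfl⟩
  · have ht : t < a (2 * k) := by omega
    have hc := cantorLen_lamSeq (q := q) ha ht
    rcases k with _ | k
    · simp only [mul_zero, Finset.range_zero, Finset.sum_empty, zero_add] at hc ht ⊢
      have hd := hM0 t (by omega)
      exact ⟨t, t, hc.ge, hC hc, hd.ge, hD hd, by omega, by omega⟩
    have h1 := ha (2 * k + 1)
    have h2 := hM k (a (2 * k + 1) - 1) (by omega)
    have h3 := hM (k + 1) 0 (ha _)
    have hs := hsplit (k + 1)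
    have e1 := Finset.sum_range_succ (fun j => a (2 * j + 1)) k
    have e2 := Finset.sum_range_succ a (2 * (k + 1))
    have e3 := Finset.sum_range_succ a (2 * k + 1)
    rw [show 2 * k + 1 + 1 = 2 * (k + 1) by ring] at e3
    refine ⟨_, a 0 + ∑ j ∈ Finset.range k, a (2 * j + 1) + (a (2 * k + 1) - 1), hc.ge, hC hc,
      ?_, ?_, ?_, ?_⟩
    · rw [h2]; exact hpow (by omega)
    · rw [show a 0 + ∑ j ∈ Finset.range k, a (2 * j + 1) + (a (2 * k + 1) - 1) + 1 =
        a 0 + ∑ j ∈ Finset.range (k + 1), a (2 * j + 1) + 0 by omega, h3]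
      exact hpow (by omega)
    · have := ha 0; omega
    · omega
  · have ht : t < a (2 * k + 1) := by omega
    have hd := hM k t ht
    have h1 := ha (2 * k)
    have h2 := cantorLen_lamSeq (q := q) ha (k := k) (t := a (2 * k) - 1) (by omega)
    have h3 := cantorLen_lamSeq (q := q) ha (k := k + 1) (t := 0) (ha _)
    have hs := hsplit k
    have e1 := Finset.sum_range_succ (fun j => a (2 * j)) k
    have e2 := Finset.sum_range_succ a (2 * k)
    have e3 := Finset.sum_range_succ a (2 * k + 1)
    rw [show 2 * k + 1 + 1 = 2 * (k + 1) by ring] at e3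
    refine ⟨∑ j ∈ Finset.range k, a (2 * j) + (a (2 * k) - 1), _, ?_, ?_, hd.ge, hD hd, ?_, ?_⟩
    · rw [h2]; exact hpow (by omega)
    · rw [show ∑ j ∈ Finset.range k, a (2 * j) + (a (2 * k) - 1) + 1 =
        ∑ j ∈ Finset.range (k + 1), a (2 * j) + 0 by omega, h3]
      exact hpow (by omega)
    · have := ha 0; omega
    · omega

end Lengths

section Product

lemma dist_fst_le (x y : WithLp 2 (ℝ × ℝ)) : |x.fst - y.fst| ≤ dist x y := by
  rw [WithLp.prod_dist_eq_of_L2, ← Real.dist_eq]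
  exact Real.le_sqrt_of_sq_le (le_add_of_nonneg_right (sq_nonneg _))

lemma dist_snd_le (x y : WithLp 2 (ℝ × ℝ)) : |x.snd - y.snd| ≤ dist x y := by
  rw [WithLp.prod_dist_eq_of_L2, ← Real.dist_eq]
  exact Real.le_sqrt_of_sq_le (le_add_of_nonneg_left (sq_nonneg _))

lemma dist_le_of_coord {x y : WithLp 2 (ℝ × ℝ)} {r R : ℝ} (h1 : |x.fst - y.fst| ≤ r)
    (h2 : |x.snd - y.snd| ≤ r) (hR : 0 ≤ R) (h : 2 * r ^ 2 ≤ R ^ 2) : dist x y ≤ R := by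
  rw [WithLp.prod_dist_eq_of_L2, Real.dist_eq, Real.dist_eq]
  refine Real.sqrt_le_iff.2 ⟨hR, ?_⟩
  have := pow_le_pow_left₀ (abs_nonneg _) h1 2
  have := pow_le_pow_left₀ (abs_nonneg _) h2 2
  linarith

lemma mem_prodSetL2 {C D : Set ℝ} {x : WithLp 2 (ℝ × ℝ)} :
    x ∈ prodSetL2 C D ↔ x.fst ∈ C ∧ x.snd ∈ D := by
  constructor
  · rintro ⟨p, hp, rfl⟩
    exact hp
  · intro h
    exact ⟨(x.fst, x.snd), h, rfl⟩

/-- The product of two finite sets of reals, inside the Euclidean plane. -/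
noncomputable def finsetProdL2 (S T : Finset ℝ) : Finset (WithLp 2 (ℝ × ℝ)) :=
  (S ×ˢ T).map (WithLp.equiv 2 (ℝ × ℝ)).symm.toEmbedding

lemma mem_finsetProdL2 {S T : Finset ℝ} {x : WithLp 2 (ℝ × ℝ)} :
    x ∈ finsetProdL2 S T ↔ x.fst ∈ S ∧ x.snd ∈ T := by
  constructor
  · intro h
    obtain ⟨p, hp, rfl⟩ := Finset.mem_map.1 h
    exact Finset.mem_product.1 hp
  · intro h
    exact Finset.mem_map.2 ⟨(x.fst, x.snd), Finset.mem_product.2 h, rfl⟩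

lemma card_finsetProdL2 (S T : Finset ℝ) : (finsetProdL2 S T).card = S.card * T.card := by
  rw [finsetProdL2, Finset.card_map, Finset.card_product]

variable {q : ℝ} {lam mu : ℕ → ℝ} {A : ℕ}

lemma generation_lt (hq : 0 < q) (hq1 : q < 1) (hanti : Antitone (cantorLen lam)) {i j c c' : ℕ}
    (hij : i ≤ j) (hc : q ^ i ≤ cantorLen lam c) (hc' : cantorLen lam (c' + 1) ≤ q ^ (j + 1)) :
    c < c' + 1 := by
  by_contra hcon
  have h1 := hanti (not_lt.1 hcon)
  have h2 : q ^ (j + 1) < q ^ i := pow_lt_pow_right_of_lt_one₀ hq hq1 (by omega)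
  linarith

lemma rpow_neg_log_two_div_log (hq : 0 < q) (hq1 : q < 1) :
    q ^ (-(Real.log 2 / Real.log q)) = 1 / 2 := by
  have hl : Real.log q ≠ 0 := (Real.log_neg hq hq1).ne
  rw [Real.rpow_def_of_pos hq, mul_neg, mul_div_cancel₀ _ hl, Real.exp_neg,
    Real.exp_log two_pos, one_div]

lemma pow_rpow_neg_log_two_div_log (hq : 0 < q) (hq1 : q < 1) (n : ℕ) :
    (q ^ n) ^ (-(Real.log 2 / Real.log q)) = (1 / 2) ^ n := by
  rw [← Real.rpow_natCast, ← Real.rpow_mul hq.le, mul_comm, Real.rpow_mul hq.le,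
    rpow_neg_log_two_div_log hq hq1, Real.rpow_natCast]

lemma neg_log_two_div_log_nonneg (hq : 0 < q) (hq1 : q < 1) :
    0 ≤ -(Real.log 2 / Real.log q) :=
  neg_nonneg.2 (div_nonpos_of_nonneg_of_nonpos (Real.log_nonneg one_le_two)
    (Real.log_neg hq hq1).le)

lemma isHomogeneous_prod_cantorSet (hq : 0 < q) (hq2 : q < 1 / 2)
    (hl : ∀ i, 0 < lam i) (hl' : ∀ i, lam i ≤ 1 / 2)
    (hm : ∀ i, 0 < mu i) (hm' : ∀ i, mu i ≤ 1 / 2)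
    (hgen : ∀ i, ∃ c d : ℕ, q ^ i ≤ cantorLen lam c ∧ cantorLen lam (c + 1) ≤ q ^ (i + 1) ∧
      q ^ i ≤ cantorLen mu d ∧ cantorLen mu (d + 1) ≤ q ^ (i + 1) ∧ i ≤ c + d ∧ c + d ≤ i + A) :
    IsHomogeneous (prodSetL2 (cantorSet lam) (cantorSet mu)) (-(Real.log 2 / Real.log q)) := by
  intro δ₀ _
  have hq1 : q < 1 := hq2.trans (by norm_num)
  set s := -(Real.log 2 / Real.log q) with hs
  set M := max δ₀ 1
  have hM1 : 1 ≤ M := le_max_right _ _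
  have hM : 0 < M := by positivity
  obtain ⟨K, hK⟩ := exists_nat_ge (2 * M)
  refine ⟨(K + 2) ^ 2 * 2 ^ (A + 4), by positivity, fun x _ δ ρ hρ hρδ hδ => ?_⟩
  have hδM : δ ≤ M := hδ.trans (le_max_left _ _)
  have hδ0 : 0 < δ := hρ.trans hρδ
  obtain ⟨i, hi1, hi2⟩ := exists_nat_pow_near_of_lt_one (div_pos hδ0 hM)
    ((div_le_one hM).2 hδM) hq hq1
  obtain ⟨j, hj1, hj2⟩ := exists_nat_pow_near_of_lt_one (div_pos hρ hM)
    ((div_le_one hM).2 (hρδ.le.trans hδM)) hq hq1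
  rw [lt_div_iff₀ hM] at hi1 hj1
  rw [div_le_iff₀ hM] at hi2 hj2
  have hij : i ≤ j := by
    by_contra hcon
    have : q ^ i ≤ q ^ (j + 1) := pow_le_pow_of_le_one hq.le hq1.le (by omega)
    nlinarith
  obtain ⟨c, d, hc, -, hd, -, hcd, -⟩ := hgen i
  obtain ⟨c', d', -, hc', -, hd', -, hcd'⟩ := hgen (j + 1)
  obtain ⟨k, hk⟩ := Nat.exists_eq_add_of_lt
    (generation_lt hq hq1 (cantorLen_anti hl hl') (by omega) hc hc')
  obtain ⟨l, hl₁⟩ := Nat.exists_eq_add_of_lt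
    (generation_lt hq hq1 (cantorLen_anti hm hm') (by omega) hd hd')
  rw [hk, add_assoc] at hc'
  rw [hl₁, add_assoc] at hd'
  have hscale : ∀ {L}, q ^ i ≤ L → 2 * δ ≤ K * L := fun {L} h => by
    have hp := pow_pos hq i
    calc 2 * δ ≤ 2 * M * q ^ i := by linarith
      _ ≤ K * L := mul_le_mul hK h hp.le (Nat.cast_nonneg _)
  obtain ⟨S, hS, hScov⟩ := exists_cantor_cover hl hl' x.fst (k + 1) (hscale hc)
  obtain ⟨T, hT, hTcov⟩ := exists_cantor_cover hm hm' x.snd (l + 1) (hscale hd)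
  have hcover : coverNum (closedBall x δ ∩ prodSetL2 (cantorSet lam) (cantorSet mu)) ρ ≤
      (finsetProdL2 S T).card := by
    refine coverNum_le_card fun y hy => ?_
    obtain ⟨hy1, hy2⟩ := hy
    rw [mem_closedBall] at hy1
    obtain ⟨hyC, hyD⟩ := mem_prodSetL2.1 hy2
    obtain ⟨u, hu, hyu⟩ := hScov _ hyC ((dist_fst_le y x).trans hy1)
    obtain ⟨v, hv, hyv⟩ := hTcov _ hyD ((dist_snd_le y x).trans hy1)
    refine ⟨WithLp.toLp 2 (u, v), mem_finsetProdL2.2 ⟨hu, hv⟩,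
      dist_le_of_coord (hyu.trans hc') (hyv.trans hd') hρ.le ?_⟩
    have hp := pow_pos hq (j + 1)
    have h1 : q ^ (j + 1) ≤ ρ := by nlinarith
    have h2 : q ^ (j + 1 + 1) ≤ q ^ (j + 1) / 2 := by rw [pow_succ]; nlinarith
    have h3 := pow_pos hq (j + 1 + 1)
    nlinarith
  refine hcover.trans ?_
  rw [← ENNReal.ofReal_natCast]
  refine ENNReal.ofReal_le_ofReal ?_
  have hratio : (1 / 2 : ℝ) ^ (i + 1) / (1 / 2) ^ j ≤ (δ / ρ) ^ s := by
    rw [← pow_rpow_neg_log_two_div_log hq hq1, ← pow_rpow_neg_log_two_div_log hq hq1,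
      ← Real.div_rpow (by positivity) (by positivity)]
    refine Real.rpow_le_rpow (by positivity) ?_ (neg_log_two_div_log_nonneg hq hq1)
    rw [div_le_div_iff₀ (pow_pos hq j) hρ]
    have hp := pow_pos hq (i + 1)
    have hp' := pow_pos hq j
    calc q ^ (i + 1) * ρ ≤ q ^ (i + 1) * (q ^ j * M) := by gcongr
      _ = (q ^ (i + 1) * M) * q ^ j := by ring
      _ ≤ δ * q ^ j := by gcongr
  have hcard : (finsetProdL2 S T).card ≤ (K + 2) ^ 2 * 2 ^ (k + l + 2) := by
    rw [card_finsetProdL2]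
    calc S.card * T.card ≤ ((K + 2) * 2 ^ (k + 1)) * ((K + 2) * 2 ^ (l + 1)) :=
          Nat.mul_le_mul hS hT
      _ = _ := by ring
  have hexp : (2 : ℝ) ^ (k + l + 2) ≤ 2 ^ (A + 4) * ((1 / 2 : ℝ) ^ (i + 1) / (1 / 2) ^ j) := by
    rw [one_div_pow, one_div_pow, div_div_div_eq, one_mul, mul_one, ← mul_div_assoc,
      le_div_iff₀ (by positivity), ← pow_add, ← pow_add]
    exact pow_le_pow_right₀ one_le_two (by omega)
  calc ((finsetProdL2 S T).card : ℝ) ≤ (K + 2) ^ 2 * 2 ^ (k + l + 2) := by exact_mod_cast hcard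
    _ ≤ (K + 2) ^ 2 * (2 ^ (A + 4) * (δ / ρ) ^ s) := by
        gcongr
        exact hexp.trans (by gcongr)
    _ = _ := by ring

lemma le_coverNum_prod_cantorSet (hq : 0 < q) (hq1 : q < 1)
    (hl : ∀ i, 0 < lam i) (hl' : ∀ i, lam i ≤ 1 / 2)
    (hm : ∀ i, 0 < mu i) (hm' : ∀ i, mu i ≤ 1 / 2)
    (hgen : ∀ i, ∃ c d : ℕ, q ^ i ≤ cantorLen lam c ∧ q ^ i ≤ cantorLen mu d ∧ i ≤ c + d)
    {r : ℝ} (hr : 0 < r) (hr1 : r < 1 / 3) :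
    ENNReal.ofReal ((q / 3) ^ (-(Real.log 2 / Real.log q)) * r ^ (-(-(Real.log 2 / Real.log q)))) ≤
      coverNum (prodSetL2 (cantorSet lam) (cantorSet mu)) r := by
  obtain ⟨j, hj1, hj2⟩ := exists_nat_pow_near_of_lt_one (x := 3 * r) (by linarith) (by linarith)
    hq hq1
  obtain ⟨c, d, hc, hd, hcd⟩ := hgen j
  have hqj := pow_pos hq j
  have hcard : ((finsetProdL2 (cantorVertices lam c) (cantorVertices mu d)).card : ℝ≥0∞) ≤
      coverNum (prodSetL2 (cantorSet lam) (cantorSet mu)) r := by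
    refine card_le_coverNum (fun x hx => ?_) fun x hx y hy hxy => ?_
    · obtain ⟨h1, h2⟩ := mem_finsetProdL2.1 hx
      exact mem_prodSetL2.2 ⟨cantorVertices_subset hl hl' h1, cantorVertices_subset hm hm' h2⟩
    · obtain ⟨h1, h2⟩ := mem_finsetProdL2.1 hx
      obtain ⟨h3, h4⟩ := mem_finsetProdL2.1 hy
      have e1 : x.fst = y.fst := by
        by_contra hne
        have := cantorVertices_separated hl hl' h1 h3 hne
        linarith [dist_fst_le x y]
      have e2 : x.snd = y.snd := by
        by_contra hne
        have := cantorVertices_separated hm hm' h2 h4 hne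
        linarith [dist_snd_le x y]
      exact (WithLp.equiv 2 (ℝ × ℝ)).injective (Prod.ext e1 e2)
  refine le_trans ?_ hcard
  rw [card_finsetProdL2, card_cantorVertices hl hl', card_cantorVertices hm hm', ← pow_add,
    ← ENNReal.ofReal_natCast]
  refine ENNReal.ofReal_le_ofReal ?_
  rw [Real.rpow_neg hr.le, ← div_eq_mul_inv, ← Real.div_rpow (by positivity) hr.le]
  have h1 : q / 3 / r ≤ (q ^ j)⁻¹ := by
    rw [div_div, ← one_div, div_le_div_iff₀ (by positivity) hqj, one_mul, mul_comm, ← pow_succ]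
    exact hj1.le
  calc (q / 3 / r) ^ (-(Real.log 2 / Real.log q))
      ≤ ((q ^ j)⁻¹) ^ (-(Real.log 2 / Real.log q)) :=
        Real.rpow_le_rpow (by positivity) h1 (neg_log_two_div_log_nonneg hq hq1)
    _ = 2 ^ j := by
        rw [Real.inv_rpow hqj.le, pow_rpow_neg_log_two_div_log hq hq1]; simp
    _ ≤ ((2 ^ (c + d) : ℕ) : ℝ) := by
        push_cast
        exact pow_le_pow_right₀ one_le_two hcd

lemma cantorSet_nonempty (hl : ∀ i, 0 < lam i) (hl' : ∀ i, lam i ≤ 1 / 2) :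
    (cantorSet lam).Nonempty :=
  ⟨_, cantorLeft_extendWord_mem hl hl' (n := 0) fun _ => false⟩

lemma prod_cantorSet_subset_closedBall {x : WithLp 2 (ℝ × ℝ)}
    (hx : x ∈ prodSetL2 (cantorSet lam) (cantorSet mu)) :
    prodSetL2 (cantorSet lam) (cantorSet mu) ⊆ closedBall x 2 := by
  intro y hy
  rw [mem_prodSetL2] at hx hy
  refine dist_le_of_coord (r := 1) ?_ ?_ (by norm_num) (by norm_num)
  · simpa [Real.dist_eq] using
      Real.dist_le_of_mem_Icc_01 (cantorSet_subset_Icc hy.1) (cantorSet_subset_Icc hx.1)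
  · simpa [Real.dist_eq] using
      Real.dist_le_of_mem_Icc_01 (cantorSet_subset_Icc hy.2) (cantorSet_subset_Icc hx.2)

end Product

theorem statement14 (q : ℝ) (hq : q ∈ Set.Ioo (0 : ℝ) (1 / 2))
    (a : ℕ → ℕ) (ha : ∀ i, 0 < a i) :
    lowerBoxDim (prodSetL2 (cantorSet (lamSeq q a)) (cantorSet (muSeq q a))) =
        -(Real.log 2 / Real.log q) ∧
      upperBoxDim (prodSetL2 (cantorSet (lamSeq q a)) (cantorSet (muSeq q a))) =
        -(Real.log 2 / Real.log q) ∧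
      assouadDim (prodSetL2 (cantorSet (lamSeq q a)) (cantorSet (muSeq q a))) =
        ((-(Real.log 2 / Real.log q) : ℝ) : EReal) := by
  obtain ⟨hq0, hq2⟩ := hq
  have hq1 : q < 1 := hq2.trans (by norm_num)
  have hl : ∀ i, 0 < lamSeq q a i := fun i => (lamSeq_mem hq0 hq1 i).1
  have hl' : ∀ i, lamSeq q a i ≤ 1 / 2 := fun i => (lamSeq_mem hq0 hq1 i).2.trans hq2.le
  have hm : ∀ i, 0 < muSeq q a i := fun i => (muSeq_mem hq0 hq1 i).1
  have hm' : ∀ i, muSeq q a i ≤ 1 / 2 := fun i => (muSeq_mem hq0 hq1 i).2.trans hq2.le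
  have hgen := exists_generations hq0 hq1 ha
  obtain ⟨u, hu⟩ := cantorSet_nonempty hl hl'
  obtain ⟨v, hv⟩ := cantorSet_nonempty hm hm'
  refine dims_eq_of_isHomogeneous (R := 2) (r₀ := 1 / 3) (neg_log_two_div_log_nonneg hq0 hq1)
    (isHomogeneous_prod_cantorSet hq0 hq2 hl hl' hm hm' hgen)
    ⟨WithLp.toLp 2 (u, v), mem_prodSetL2.2 ⟨hu, hv⟩⟩ two_pos
    (fun x hx => prod_cantorSet_subset_closedBall hx)
    (Real.rpow_pos_of_pos (by positivity : 0 < q / 3) _) (by norm_num) fun r hr hr1 =>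
      le_coverNum_prod_cantorSet hq0 hq1 hl hl' hm hm' (fun i => ?_) hr hr1
  obtain ⟨c, d, hc, -, hd, -, hcd, -⟩ := hgen i
  exact ⟨c, d, hc, hd, hcd⟩

end Paper
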